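/- Let A > 0 and let N_0 ≥ max{1, A} be an integer. Suppose |ξ_q| ≤ A for all integers q ≥ N_0. Then for all integers p_1 ≥ N_0 and all p > p_1: |∏_{p_1<q<p} (1 + ξ_q/q³)^{p_1} − 1| ≤ A/p_1. -/

import Mathlib

open Finset

theorem sum_Ioo_inv_cube_le (n p : ℕ) (hn : 1 ≤ n) (hp : n < p) :
    ∑ q ∈ Finset.Ioo n p, 1 / (q : ℝ) ^ 3 ≤
      1 / (2 * n * (n + 1)) - 1 / (2 * ((p : ℝ) - 1) * p) := by
  induction p, hp using Nat.le_induction with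
  | base =>
    have h : Finset.Ioo n n.succ = ∅ := by ext; simp
    simp [h]
  | succ p hp ih =>
    have h : Finset.Ioo n (p + 1) = insert p (Finset.Ioo n p) := by ext; simp; omega
    rw [h, Finset.sum_insert (by simp)]
    have hp2 : (2 : ℝ) ≤ p := by exact_mod_cast (by omega : 2 ≤ p)
    have hp1 : (0 : ℝ) < (p : ℝ) - 1 := by linarith
    have key : 1 / (p : ℝ) ^ 3 ≤
        1 / (2 * ((p : ℝ) - 1) * p) - 1 / (2 * (p : ℝ) * (p + 1)) := by
      have e : 1 / (2 * ((p : ℝ) - 1) * p) - 1 / (2 * (p : ℝ) * (p + 1)) =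
          1 / (((p : ℝ) - 1) * p * (p + 1)) := by
        field_simp
        ring
      rw [e]
      apply one_div_le_one_div_of_le (by positivity)
      nlinarith
    push_cast
    rw [add_sub_cancel_right]
    linarith

theorem abs_prod_one_add_pow_sub_one_le {ι : Type*} (s : Finset ι) (f : ι → ℝ) (n : ℕ) :
    |(∏ i ∈ s, (1 + f i) ^ n) - 1| ≤ Real.exp (n * ∑ i ∈ s, |f i|) - 1 := by
  have h := Finset.norm_prod_one_add_sub_one_le (s ×ˢ Finset.range n) (fun x => f x.1)
  simpa [Finset.prod_product, Finset.sum_product, Finset.mul_sum] using h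

/-- Lemma 6.3: if `|ξ_q| ≤ A` for `q ≥ N₀ ≥ max{1, A}`, then for all
`p₁ ≥ N₀` and `p > p₁`: `|∏_{p₁<q<p} (1+ξ_q/q³)^{p₁} − 1| ≤ A/p₁`. -/
theorem stmt_12 (A : ℝ) (hA : 0 < A) (N₀ : ℕ) (hN₀1 : 1 ≤ N₀) (hN₀A : A ≤ (N₀ : ℝ))
    (ξ : ℕ → ℝ) (hξ : ∀ q : ℕ, N₀ ≤ q → |ξ q| ≤ A) :
    ∀ p1 p : ℕ, N₀ ≤ p1 → p1 < p →
      |(∏ q ∈ Finset.Ioo p1 p, (1 + ξ q / (q : ℝ) ^ 3) ^ p1) - 1| ≤ A / (p1 : ℝ) := by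
  intro p1 p h1 hp
  have hp1 : (1 : ℝ) ≤ p1 := by exact_mod_cast hN₀1.trans h1
  have hA1 : A ≤ p1 := hN₀A.trans (by exact_mod_cast h1)
  have hpp : (p1 : ℝ) + 1 ≤ p := by exact_mod_cast hp
  refine (abs_prod_one_add_pow_sub_one_le _ _ _).trans ?_
  have hsum : ∑ q ∈ Finset.Ioo p1 p, |ξ q / (q : ℝ) ^ 3| ≤ A * (1 / (2 * p1 * (p1 + 1))) := by
    calc ∑ q ∈ Finset.Ioo p1 p, |ξ q / (q : ℝ) ^ 3|
        ≤ ∑ q ∈ Finset.Ioo p1 p, A * (1 / (q : ℝ) ^ 3) := by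
          refine Finset.sum_le_sum fun q hq => ?_
          have hq' := (Finset.mem_Ioo.mp hq).1
          rw [abs_div, abs_of_nonneg (by positivity : (0 : ℝ) ≤ (q : ℝ) ^ 3), mul_one_div]
          gcongr
          exact hξ q (by omega)
      _ = A * ∑ q ∈ Finset.Ioo p1 p, 1 / (q : ℝ) ^ 3 := by rw [Finset.mul_sum]
      _ ≤ A * (1 / (2 * p1 * (p1 + 1))) := by
          gcongr
          refine (sum_Ioo_inv_cube_le p1 p (hN₀1.trans h1) hp).trans (sub_le_self _ ?_)
          have : (0 : ℝ) ≤ (p : ℝ) - 1 := by linarith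
          positivity
  set S := (p1 : ℝ) * ∑ q ∈ Finset.Ioo p1 p, |ξ q / (q : ℝ) ^ 3| with hS
  have hS0 : 0 ≤ S := by positivity
  have hS1 : S ≤ A / (2 * p1) := by
    calc S ≤ p1 * (A * (1 / (2 * p1 * (p1 + 1)))) := by rw [hS]; gcongr
      _ = A / (2 * (p1 + 1)) := by field_simp
      _ ≤ A / (2 * p1) := by gcongr; linarith
  have hS2 : S ≤ 1 := hS1.trans (by rw [div_le_one (by positivity)]; linarith)
  have hexp := Real.abs_exp_sub_one_le (x := S) (by rwa [abs_of_nonneg hS0])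
  rw [abs_of_nonneg hS0] at hexp
  calc Real.exp S - 1 ≤ 2 * S := (le_abs_self _).trans hexp
    _ ≤ 2 * (A / (2 * p1)) := by gcongr
    _ = A / p1 := by field_simp
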